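/- Fix x, y ∈ ℝ^d. Let Q^serv be an unbiased compressor with parameter q^serv and, for m = 1,…,M, let Q_m^dev be unbiased compressors with parameters q_m^dev; assume all these compressor evaluations are mutually independent. Then E[‖Q^serv[(1/M)·∑_{m=1}^M Q_m^dev(F_m(x) − F_m(y))] + F(y) − F(x)‖²] ≤ (C_q² + 2·L̃²)·‖x − y‖², where C_q² := (q^serv/M²)·∑_{m=1}^M (q_m^dev·L_m² + (M−1)·L̃²). -/

import Mathlib

open MeasureTheory ProbabilityTheory Finset
open scoped RealInnerProductSpace ENNReal

theorem norm_sum_sq_add_sum_sub_le {E : Type*} [SeminormedAddCommGroup E] {M : ℕ} (hM : 0 < M)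
    {a : Fin M → E} {q v ℓ : Fin M → ℝ} {r t : ℝ} (hq : ∀ m, 1 ≤ q m)
    (hv : ∀ m, v m ≤ q m * ‖a m‖ ^ 2) (ha : ∀ m, ‖a m‖ ^ 2 ≤ ℓ m ^ 2 * r ^ 2)
    (ht : t ^ 2 = (M : ℝ)⁻¹ * ∑ m, ℓ m ^ 2) :
    ‖∑ m, a m‖ ^ 2 + ∑ m, (v m - ‖a m‖ ^ 2) ≤
      (∑ m, (q m * ℓ m ^ 2 + ((M : ℝ) - 1) * t ^ 2)) * r ^ 2 := by
  have hM1 : (1 : ℝ) ≤ M := by exact_mod_cast hM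
  have hcs : ‖∑ m, a m‖ ^ 2 ≤ M * ∑ m, ‖a m‖ ^ 2 := by
    calc ‖∑ m, a m‖ ^ 2 ≤ (∑ m, ‖a m‖) ^ 2 := by gcongr; exact norm_sum_le _ _
      _ ≤ _ := by simpa using sq_sum_le_card_mul_sum_sq (s := univ) (f := fun m => ‖a m‖)
  have hsum : ∑ m, ℓ m ^ 2 = M * t ^ 2 := by rw [ht]; field_simp
  calc _ ≤ M * ∑ m, ‖a m‖ ^ 2 + ∑ m, (q m * ‖a m‖ ^ 2 - ‖a m‖ ^ 2) := by
        gcongr with m; exact hv m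
    _ = ∑ m, (q m + (M - 1)) * ‖a m‖ ^ 2 := by
        rw [Finset.mul_sum, ← Finset.sum_add_distrib]
        exact Finset.sum_congr rfl fun m _ => by ring
    _ ≤ ∑ m, (q m + (M - 1)) * (ℓ m ^ 2 * r ^ 2) := by
        gcongr with m
        · linarith [hq m]
        · exact ha m
    _ = _ := by
        simp only [← mul_assoc, ← Finset.sum_mul, add_mul, Finset.sum_add_distrib,
          ← Finset.mul_sum, hsum, Finset.sum_const, Finset.card_univ, Fintype.card_fin,
          nsmul_eq_mul]
        ring

theorem ProbabilityTheory.IndepFun.memLp_two_left_of_add {Ω E : Type*}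
    [MeasurableSpace Ω] {μ : Measure Ω} [IsProbabilityMeasure μ] [NormedAddCommGroup E]
    [SecondCountableTopology E] [MeasurableSpace E] [BorelSpace E] {X Y : Ω → E}
    (hXY : IndepFun X Y μ) (hX : Measurable X) (hY : Measurable Y)
    (h : MemLp (fun ω => X ω + Y ω) 2 μ) : MemLp X 2 μ := by
  have : IsProbabilityMeasure (μ.map Y) := Measure.isProbabilityMeasure_map hY.aemeasurable
  have hint : Integrable (fun z : E × E => ‖z.1 + z.2‖ ^ 2) ((μ.map X).prod (μ.map Y)) := by
    rw [← hXY.map_prod_eq_prod_map_map hX.aemeasurable hY.aemeasurable,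
      integrable_map_measure (by fun_prop) (by fun_prop)]
    exact h.integrable_norm_pow two_ne_zero
  obtain ⟨y, hy⟩ := hint.prod_left_ae.exists
  have hy' : MemLp (fun x => x + y) 2 (μ.map X) :=
    (memLp_two_iff_integrable_sq_norm (by fun_prop)).2 hy
  have hid : MemLp (fun x : E => x) 2 (μ.map X) := by
    have : IsProbabilityMeasure (μ.map X) := Measure.isProbabilityMeasure_map hX.aemeasurable
    simpa [Pi.sub_def] using hy'.sub (memLp_const y)
  exact (memLp_map_measure_iff (by fun_prop) hX.aemeasurable).1 hid

section CompressedVariance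

variable {Ω E : Type*} [MeasurableSpace Ω] {μ : Measure Ω}
  [NormedAddCommGroup E] [InnerProductSpace ℝ E] [CompleteSpace E]
  [MeasurableSpace E] [BorelSpace E]

theorem ProbabilityTheory.IndepFun.integral_norm_add_sq [IsFiniteMeasure μ] {X Y : Ω → E}
    (hXY : IndepFun X Y μ) (hX : MemLp X 2 μ) (hY : MemLp Y 2 μ) :
    ∫ ω, ‖X ω + Y ω‖ ^ 2 ∂μ =
      ∫ ω, ‖X ω‖ ^ 2 ∂μ + 2 * ⟪∫ ω, X ω ∂μ, ∫ ω, Y ω ∂μ⟫ + ∫ ω, ‖Y ω‖ ^ 2 ∂μ := by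
  have hX2 : Integrable (fun ω => ‖X ω‖ ^ 2) μ := hX.integrable_norm_pow two_ne_zero
  have hY2 : Integrable (fun ω => ‖Y ω‖ ^ 2) μ := hY.integrable_norm_pow two_ne_zero
  have hinner : Integrable (fun ω => ⟪X ω, Y ω⟫) μ :=
    hXY.integrable_bilin (hX.integrable one_le_two) (hY.integrable one_le_two) (innerSL ℝ)
  have hbilin : ∫ ω, ⟪X ω, Y ω⟫ ∂μ = ⟪∫ ω, X ω ∂μ, ∫ ω, Y ω ∂μ⟫ :=
    hXY.integral_bilin (hX.integrable one_le_two) (hY.integrable one_le_two) (innerSL ℝ)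
  simp_rw [norm_add_sq_real]
  rw [integral_add (by exact hX2.add (hinner.const_mul 2)) hY2, integral_add hX2 (hinner.const_mul 2),
    integral_const_mul, hbilin]

theorem integral_norm_sub_const_sq [IsProbabilityMeasure μ] {X : Ω → E} (hX : MemLp X 2 μ)
    (c : E) :
    ∫ ω, ‖X ω - c‖ ^ 2 ∂μ =
      ∫ ω, ‖X ω‖ ^ 2 ∂μ - 2 * ⟪∫ ω, X ω ∂μ, c⟫ + ‖c‖ ^ 2 := by
  have h := (indepFun_const_right (μ := μ) X (-c)).integral_norm_add_sq hX (memLp_const _)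
  simpa [← sub_eq_add_neg] using h

theorem norm_integral_sq_le_integral_norm_sq [IsProbabilityMeasure μ] {X : Ω → E}
    (hX : MemLp X 2 μ) : ‖∫ ω, X ω ∂μ‖ ^ 2 ≤ ∫ ω, ‖X ω‖ ^ 2 ∂μ := by
  have h := integral_norm_sub_const_sq hX (∫ ω, X ω ∂μ)
  have h0 : 0 ≤ ∫ ω, ‖X ω - ∫ ω, X ω ∂μ‖ ^ 2 ∂μ := integral_nonneg fun _ => by positivity
  rw [real_inner_self_eq_norm_sq] at h
  linarith

variable [SecondCountableTopology E]

theorem ProbabilityTheory.iIndepFun.integral_norm_sum_sq [IsProbabilityMeasure μ] {ι : Type*}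
    {X : ι → Ω → E} (hX : iIndepFun X μ) (hmeas : ∀ i, Measurable (X i))
    (hL2 : ∀ i, MemLp (X i) 2 μ) (s : Finset ι) :
    ∫ ω, ‖∑ i ∈ s, X i ω‖ ^ 2 ∂μ =
      ‖∑ i ∈ s, ∫ ω, X i ω ∂μ‖ ^ 2 + ∑ i ∈ s, (∫ ω, ‖X i ω‖ ^ 2 ∂μ - ‖∫ ω, X i ω ∂μ‖ ^ 2) := by
  classical
  induction s using Finset.induction_on with
  | empty => simp
  | insert i s hi ih =>
    have hind : IndepFun (X i) (fun ω => ∑ j ∈ s, X j ω) μ := by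
      have h := (hX.indepFun_finsetSum_of_notMem hmeas hi).symm
      rwa [show ∑ j ∈ s, X j = fun ω => ∑ j ∈ s, X j ω from
        funext fun ω => Finset.sum_apply ω s X] at h
    simp only [Finset.sum_insert hi]
    rw [hind.integral_norm_add_sq (hL2 i) (memLp_finsetSum s fun j _ => hL2 j), ih,
      integral_finsetSum s fun j _ => (hL2 j).integrable one_le_two, norm_add_sq_real]
    ring

theorem memLp_and_integral_norm_sub_sq_le_of_unbiased {Ω' : Type*} [MeasurableSpace Ω']
    {ν : Measure Ω'} [IsProbabilityMeasure μ] [IsProbabilityMeasure ν]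
    {Q : E → Ω' → E} {q : ℝ} (hQ : Measurable (Function.uncurry Q))
    (hmean : ∀ x, ∫ ω, Q x ω ∂ν = x) (hmoment : ∀ x, ∫ ω, ‖Q x ω‖ ^ 2 ∂ν ≤ q * ‖x‖ ^ 2)
    {W : Ω → E} (hW : Measurable W) (c : E)
    (hint : Integrable (fun p : Ω × Ω' => ‖Q (W p.1) p.2 - c‖ ^ 2) (μ.prod ν)) :
    MemLp W 2 μ ∧ ∫ p, ‖Q (W p.1) p.2 - c‖ ^ 2 ∂(μ.prod ν) ≤
      q * ∫ ω, ‖W ω‖ ^ 2 ∂μ - 2 * ⟪∫ ω, W ω ∂μ, c⟫ + ‖c‖ ^ 2 := by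
  have hQW : Measurable fun p : Ω × Ω' => Q (W p.1) p.2 :=
    hQ.comp ((hW.comp measurable_fst).prodMk measurable_snd)
  have hsection : ∀ᵐ ω ∂μ, MemLp (fun ω' => Q (W ω) ω') 2 ν := by
    filter_upwards [hint.prod_right_ae] with ω hω
    have hm : Measurable fun ω' => Q (W ω) ω' := hQW.comp measurable_prodMk_left
    have h := ((memLp_two_iff_integrable_sq_norm
      (hm.sub_const c).aestronglyMeasurable).2 hω).add (memLp_const c)
    simpa [Pi.add_def] using h
  have hQL2 : MemLp (fun p : Ω × Ω' => Q (W p.1) p.2) 2 (μ.prod ν) := by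
    have h := ((memLp_two_iff_integrable_sq_norm
      (hQW.sub_const c).aestronglyMeasurable).2 hint).add (memLp_const c)
    simpa [Pi.add_def] using h
  have hWL2 : MemLp W 2 μ := by
    refine (memLp_two_iff_integrable_sq_norm hW.aestronglyMeasurable).2 ?_
    refine (hQL2.integrable_norm_pow two_ne_zero).integral_prod_left.mono'
      (by fun_prop) ?_
    filter_upwards [hsection] with ω hω
    have h := norm_integral_sq_le_integral_norm_sq hω
    rw [hmean] at h
    simpa using h
  refine ⟨hWL2, ?_⟩
  have hW2 : Integrable (fun ω => q * ‖W ω‖ ^ 2) μ :=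
    (hWL2.integrable_norm_pow two_ne_zero).const_mul q
  have hQ2 := hQL2.integrable_norm_pow two_ne_zero
  have hmeanQ : ∫ p, Q (W p.1) p.2 ∂(μ.prod ν) = ∫ ω, W ω ∂μ := by
    rw [integral_prod _ (hQL2.integrable one_le_two)]
    simp only [hmean]
  rw [integral_norm_sub_const_sq hQL2, hmeanQ, integral_prod _ hQ2, ← integral_const_mul]
  gcongr
  · exact hQ2.integral_prod_left
  · exact fun ω => hmoment (W ω)

theorem memLp_and_integral_norm_sum_sq_pi {ι : Type*} [Fintype ι] {Ω : ι → Type*}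
    [∀ i, MeasurableSpace (Ω i)] {μ : ∀ i, Measure (Ω i)} [∀ i, IsProbabilityMeasure (μ i)]
    {X : ∀ i, Ω i → E} (hX : ∀ i, Measurable (X i))
    (hL2 : MemLp (fun ω : ∀ i, Ω i => ∑ i, X i (ω i)) 2 (Measure.pi μ)) :
    (∀ i, MemLp (X i) 2 (μ i)) ∧
    ∫ ω, ‖∑ i, X i (ω i)‖ ^ 2 ∂(Measure.pi μ) = ‖∑ i, ∫ ω, X i ω ∂(μ i)‖ ^ 2 +
      ∑ i, (∫ ω, ‖X i ω‖ ^ 2 ∂(μ i) - ‖∫ ω, X i ω ∂(μ i)‖ ^ 2) := by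
  classical
  have hind : iIndepFun (fun i (ω : ∀ i, Ω i) => X i (ω i)) (Measure.pi μ) :=
    iIndepFun_pi fun i => (hX i).aemeasurable
  have hmeas : ∀ i, Measurable fun ω : ∀ i, Ω i => X i (ω i) :=
    fun i => (hX i).comp (measurable_pi_apply i)
  have hmp := fun i => measurePreserving_eval μ i
  have hpiL2 : ∀ i, MemLp (fun ω : ∀ i, Ω i => X i (ω i)) 2 (Measure.pi μ) := by
    intro i
    have h := (hind.indepFun_finsetSum_of_notMem hmeas (Finset.notMem_erase i univ)).symm
    refine h.memLp_two_left_of_add (hmeas i) (by fun_prop) ?_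
    convert! hL2 using 2 with ω
    rw [Finset.sum_apply, Finset.add_sum_erase _ (fun j => X j (ω j)) (Finset.mem_univ i)]
  refine ⟨fun i => ?_, ?_⟩
  · rw [← (hmp i).map_eq, memLp_map_measure_iff (hX i).aestronglyMeasurable
      (hmp i).measurable.aemeasurable]
    exact hpiL2 i
  · rw [hind.integral_norm_sum_sq hmeas hpiL2 univ]
    have hnorm : ∀ i, ∫ ω : ∀ i, Ω i, ‖X i (ω i)‖ ^ 2 ∂(Measure.pi μ) =
        ∫ ω, ‖X i ω‖ ^ 2 ∂(μ i) := fun i =>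
      integral_comp_eval ((hX i).norm.pow_const 2).aestronglyMeasurable
    simp only [integral_comp_eval (hX _).aestronglyMeasurable, hnorm]

end CompressedVariance

/-- **Variance bound for the compressed difference estimator** (key estimate in the
monotone-case MASHA1 analysis): for fixed `x, y`,
`E‖Q^serv[(1/M)·∑_m Q_m^dev(F_m(x) - F_m(y))] + F(y) - F(x)‖² ≤ (C_q² + 2L̃²)·‖x - y‖²`,
the expectation being over the (mutually independent) compressor randomness. -/
theorem masha1_compressed_variance
    {d M : ℕ} (hM : 0 < M)
    -- the operators
    (Fm : Fin M → EuclideanSpace ℝ (Fin d) → EuclideanSpace ℝ (Fin d))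
    (F : EuclideanSpace ℝ (Fin d) → EuclideanSpace ℝ (Fin d))
    (hFdef : ∀ x, F x = (M : ℝ)⁻¹ • ∑ m, Fm m x)
    -- Lipschitz assumptions
    (L : ℝ) (Lm : Fin M → ℝ)
    (hLipF : LipschitzWith (Real.toNNReal L) F)
    (hLipFm : ∀ m, LipschitzWith (Real.toNNReal (Lm m)) (Fm m))
    (Ltilde : ℝ) (hLt : Ltilde = Real.sqrt ((M : ℝ)⁻¹ * ∑ m, Lm m ^ 2))
    -- unbiased compressors: server with parameter `q^serv`, devices with `q_m^dev`;
    -- all evaluations are mutually independent (product randomness)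
    {Ωs Ωd : Type*} [MeasurableSpace Ωs] [MeasurableSpace Ωd]
    (μs : Measure Ωs) (μd : Measure Ωd)
    [IsProbabilityMeasure μs] [IsProbabilityMeasure μd]
    (Qserv : EuclideanSpace ℝ (Fin d) → Ωs → EuclideanSpace ℝ (Fin d))
    (Qdev : Fin M → EuclideanSpace ℝ (Fin d) → Ωd → EuclideanSpace ℝ (Fin d))
    (qserv : ℝ) (qdev : Fin M → ℝ)
    (hqserv : 1 ≤ qserv) (hqdev : ∀ m, 1 ≤ qdev m)
    (hQservMeas : Measurable (Function.uncurry Qserv))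
    (hQdevMeas : ∀ m, Measurable (Function.uncurry (Qdev m)))
    (hQservUnbiased : ∀ x, ∫ ω, Qserv x ω ∂μs = x)
    (hQservMoment : ∀ x, ∫ ω, ‖Qserv x ω‖ ^ 2 ∂μs ≤ qserv * ‖x‖ ^ 2)
    (hQdevUnbiased : ∀ m x, ∫ ω, Qdev m x ω ∂μd = x)
    (hQdevMoment : ∀ m x, ∫ ω, ‖Qdev m x ω‖ ^ 2 ∂μd ≤ qdev m * ‖x‖ ^ 2)
    (Cq : ℝ)
    (hCq : Cq = Real.sqrt (qserv / (M : ℝ) ^ 2 *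
      ∑ m, (qdev m * Lm m ^ 2 + ((M : ℝ) - 1) * Ltilde ^ 2)))
    (x y : EuclideanSpace ℝ (Fin d)) :
    ∫ p, ‖Qserv ((M : ℝ)⁻¹ • ∑ m, Qdev m (Fm m x - Fm m y) (p.1 m)) p.2
          + F y - F x‖ ^ 2
        ∂((Measure.pi fun _ : Fin M => μd).prod μs) ≤
      (Cq ^ 2 + 2 * Ltilde ^ 2) * ‖x - y‖ ^ 2 := by
  have hM' : (0 : ℝ) < M := by exact_mod_cast hM
  have hM1 : (1 : ℝ) ≤ M := by exact_mod_cast hM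
  have hLt2 : Ltilde ^ 2 = (M : ℝ)⁻¹ * ∑ m, Lm m ^ 2 := by
    rw [hLt, Real.sq_sqrt (by positivity)]
  have hCq2 : Cq ^ 2 = qserv / (M : ℝ) ^ 2 *
      ∑ m, (qdev m * Lm m ^ 2 + ((M : ℝ) - 1) * Ltilde ^ 2) := by
    rw [hCq, Real.sq_sqrt]
    refine mul_nonneg (by positivity) (Finset.sum_nonneg fun m _ => ?_)
    have := hqdev m
    have := sub_nonneg.2 hM1
    positivity
  set a : Fin M → EuclideanSpace ℝ (Fin d) := fun m => Fm m x - Fm m y with ha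
  set c := F x - F y with hc
  set W : (Fin M → Ωd) → EuclideanSpace ℝ (Fin d) :=
    fun ω => (M : ℝ)⁻¹ • ∑ m, Qdev m (a m) (ω m) with hWdef
  have hmeas : ∀ m, Measurable (Qdev m (a m)) :=
    fun m => (hQdevMeas m).comp measurable_prodMk_left
  have hW : Measurable W :=
    Measurable.const_smul (g := fun ω : Fin M → Ωd => ∑ m, Qdev m (a m) (ω m))
      (by fun_prop) (M : ℝ)⁻¹
  have hLip : ∀ m, ‖a m‖ ^ 2 ≤ Lm m ^ 2 * ‖x - y‖ ^ 2 := by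
    intro m
    have h := (hLipFm m).norm_sub_le x y
    have hle : (Real.toNNReal (Lm m) : ℝ) ≤ |Lm m| := by
      rw [Real.coe_toNNReal']; exact max_le (le_abs_self _) (abs_nonneg _)
    calc ‖a m‖ ^ 2 ≤ (|Lm m| * ‖x - y‖) ^ 2 := by
          gcongr; exact h.trans (by gcongr)
      _ = _ := by rw [mul_pow, sq_abs]
  suffices h : ∫ p, ‖Qserv (W p.1) p.2 - c‖ ^ 2
      ∂((Measure.pi fun _ : Fin M => μd).prod μs) ≤
        (Cq ^ 2 + 2 * Ltilde ^ 2) * ‖x - y‖ ^ 2 by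
    refine le_of_eq_of_le (integral_congr_ae (.of_forall fun p => ?_)) h
    simp only [hWdef, ha, hc, sub_sub_eq_add_sub]
  by_cases hint : Integrable (fun p : (Fin M → Ωd) × Ωs => ‖Qserv (W p.1) p.2 - c‖ ^ 2)
      ((Measure.pi fun _ : Fin M => μd).prod μs)
  swap
  · rw [integral_undef hint]; positivity
  obtain ⟨hWL2, hbound⟩ := memLp_and_integral_norm_sub_sq_le_of_unbiased hQservMeas
    hQservUnbiased hQservMoment hW c hint
  have hSL2 : MemLp (fun ω : Fin M → Ωd => ∑ m, Qdev m (a m) (ω m)) 2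
      (Measure.pi fun _ => μd) := by
    have h := hWL2.const_smul (M : ℝ)
    convert! h using 2 with ω
    simp [hWdef, smul_smul, hM'.ne']
  obtain ⟨hdevL2, hsum⟩ := memLp_and_integral_norm_sum_sq_pi hmeas hSL2
  simp only [hQdevUnbiased] at hsum
  have hmeanW : ∫ ω, W ω ∂(Measure.pi fun _ => μd) = c := by
    have hi : ∀ m, Integrable (fun ω : Fin M → Ωd => Qdev m (a m) (ω m))
        (Measure.pi fun _ => μd) := fun m =>
      ((measurePreserving_eval (fun _ => μd) m).integrable_comp
        (hmeas m).aestronglyMeasurable).2 ((hdevL2 m).integrable one_le_two)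
    rw [hWdef, integral_smul, integral_finsetSum _ fun m _ => hi m]
    simp only [integral_comp_eval (μ := fun _ : Fin M => μd) (hmeas _).aestronglyMeasurable,
      hQdevUnbiased]
    rw [hc, hFdef, hFdef, ← smul_sub, ← Finset.sum_sub_distrib]
  have hW2 : ∫ ω, ‖W ω‖ ^ 2 ∂(Measure.pi fun _ => μd) =
      ((M : ℝ) ^ 2)⁻¹ * ∫ ω, ‖∑ m, Qdev m (a m) (ω m)‖ ^ 2 ∂(Measure.pi fun _ => μd) := by
    rw [← integral_const_mul]
    simp [hWdef, norm_smul, mul_pow]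
  have hS : ∫ ω, ‖∑ m, Qdev m (a m) (ω m)‖ ^ 2 ∂(Measure.pi fun _ => μd) ≤
      (∑ m, (qdev m * Lm m ^ 2 + ((M : ℝ) - 1) * Ltilde ^ 2)) * ‖x - y‖ ^ 2 := by
    rw [hsum]
    exact norm_sum_sq_add_sum_sub_le hM hqdev (fun m => hQdevMoment m (a m)) hLip hLt2
  calc _ ≤ _ := hbound
    _ ≤ qserv * ∫ ω, ‖W ω‖ ^ 2 ∂(Measure.pi fun _ => μd) := by
        rw [hmeanW, real_inner_self_eq_norm_sq]
        linarith [sq_nonneg ‖c‖]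
    _ ≤ qserv * (((M : ℝ) ^ 2)⁻¹ * ((∑ m, (qdev m * Lm m ^ 2 +
          ((M : ℝ) - 1) * Ltilde ^ 2)) * ‖x - y‖ ^ 2)) := by rw [hW2]; gcongr
    _ = Cq ^ 2 * ‖x - y‖ ^ 2 := by rw [hCq2]; ring
    _ ≤ (Cq ^ 2 + 2 * Ltilde ^ 2) * ‖x - y‖ ^ 2 := by
        gcongr; linarith [sq_nonneg Ltilde]
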